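/- For every m ≥ 1 there is a constant C (with C ≤ 2^{m/2}/π^{1/4} asymptotically) such that the m-th derivative of the normalized Hermite function satisfies ‖ψ_n^{(m)}‖_{L^∞(ℝ)} ≤ C (n+1)^{m/2} for all n. -/

import Mathlib

open Real MeasureTheory

/-- The (physicists') Hermite polynomial, via the Rodrigues formula. -/
noncomputable def hermiteH (n : ℕ) (x : ℝ) : ℝ :=
  (-1 : ℝ) ^ n * Real.exp (x ^ 2) * iteratedDeriv n (fun t : ℝ => Real.exp (-t ^ 2)) x

/-- The normalized Hermite function `ψ_n(x) = e^{-x²/2} H_n(x) / √(2ⁿ n! √π)`. -/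
noncomputable def hermitePsi (n : ℕ) (x : ℝ) : ℝ :=
  Real.exp (-x ^ 2 / 2) * hermiteH n x / Real.sqrt (2 ^ n * n.factorial * Real.sqrt π)


lemma hp_cos_lower (a t : ℝ) (ha : 0 ≤ a) (ha' : a ≤ π) (ht : 0 ≤ t) (ht' : t ≤ π) :
    (t - a) ^ 2 / 8 ≤ |Real.cos t - Real.cos a| := by
  wlog h : a ≤ t generalizing a t
  · have := this t a ht ht' ha ha' (le_of_not_ge h)
    rw [abs_sub_comm]
    linarith [show (a - t) ^ 2 = (t - a) ^ 2 by ring]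
  have hpi := Real.pi_pos
  have hpi4 := Real.pi_le_four
  rw [Real.cos_sub_cos]
  have h1 : 2 / π * ((t - a) / 2) ≤ Real.sin ((t - a) / 2) :=
    Real.mul_le_sin (by linarith) (by linarith)
  have h2 : (t - a) / 4 ≤ Real.sin ((t - a) / 2) := by
    refine le_trans ?_ h1
    have : (1 : ℝ) / 2 ≤ 2 / π := by
      rw [div_le_div_iff₀ (by norm_num) hpi]; linarith
    nlinarith
  have h3 : Real.sin ((t - a) / 2) ≤ Real.sin ((t + a) / 2) := by
    rcases le_total ((t + a) / 2) (π / 2) with h4 | h4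
    · exact Real.sin_le_sin_of_le_of_le_pi_div_two (by linarith) h4 (by linarith)
    · rw [← Real.sin_pi_sub ((t + a) / 2)]
      exact Real.sin_le_sin_of_le_of_le_pi_div_two (by linarith) (by linarith) (by linarith)
  have h5 : 0 ≤ (t - a) / 4 := by linarith
  rw [abs_mul, abs_mul, abs_of_nonneg (h5.trans h2), abs_of_nonneg ((h5.trans h2).trans h3)]
  norm_num
  nlinarith [mul_le_mul h2 (h2.trans h3) h5 (h5.trans h2)]

lemma hp_exists_angle (u : ℝ) : ∃ a : ℝ, 0 ≤ a ∧ a ≤ π ∧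
    ∀ t, 0 ≤ t → t ≤ π → ((t - a) ^ 2 / 8) ^ 2 ≤ (Real.cos t - u) ^ 2 := by
  have key : ∃ a : ℝ, 0 ≤ a ∧ a ≤ π ∧
      ∀ t, |Real.cos t - Real.cos a| ≤ |Real.cos t - u| := by
    rcases le_total u (-1) with h | h
    · refine ⟨π, Real.pi_pos.le, le_rfl, fun t => ?_⟩
      have := Real.neg_one_le_cos t
      rw [Real.cos_pi, abs_of_nonneg (by linarith), abs_of_nonneg (by linarith)]
      linarith
    rcases le_total 1 u with h' | h'
    · refine ⟨0, le_rfl, Real.pi_pos.le, fun t => ?_⟩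
      have := Real.cos_le_one t
      rw [Real.cos_zero, abs_of_nonpos (by linarith), abs_of_nonpos (by linarith)]
      linarith
    · exact ⟨Real.arccos u, Real.arccos_nonneg u, Real.arccos_le_pi u, fun t => by
        rw [Real.cos_arccos h h']⟩
  obtain ⟨a, h0, h1, h2⟩ := key
  refine ⟨a, h0, h1, fun t ht ht' => ?_⟩
  rw [← sq_abs (Real.cos t - u)]
  exact pow_le_pow_left₀ (by positivity) ((hp_cos_lower a t h0 h1 ht ht').trans (h2 t)) 2

lemma hp_integral_bound (r u : ℝ) (hr : 0 < r) :
    ∫ t in (0 : ℝ)..2 * π, Real.exp (-(2 * r ^ 2 * (Real.cos t - u) ^ 2)) ≤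
      4 * Real.exp 1 * √(π / r) := by
  obtain ⟨a, ha, ha', h⟩ := hp_exists_angle u
  have hpi := Real.pi_pos
  set G : ℝ → ℝ := fun y => Real.exp 1 * Real.exp (-(r / 4) * y ^ 2) with hG
  have hGint : Integrable G := (integrable_exp_neg_mul_sq (by positivity)).const_mul _
  have hGval : ∫ y, G y = 2 * Real.exp 1 * √(π / r) := by
    rw [hG, integral_const_mul, integral_gaussian,
      show π / (r / 4) = 2 ^ 2 * (π / r) by field_simp; norm_num,
      Real.sqrt_mul (by positivity), Real.sqrt_sq (by norm_num)]
    ring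
  have hGpos : ∀ y, 0 ≤ G y := fun y => by positivity
  have hcore : ∀ t, 0 ≤ t → t ≤ π →
      Real.exp (-(2 * r ^ 2 * (Real.cos t - u) ^ 2)) ≤ G (t - a) := by
    intro t ht ht'
    rw [hG]
    simp only
    rw [← Real.exp_add, Real.exp_le_exp]
    have h1 := mul_le_mul_of_nonneg_left (h t ht ht') (show 0 ≤ 2 * r ^ 2 by positivity)
    nlinarith [sq_nonneg (r * (t - a) ^ 2 - 4)]
  have hpt : ∀ t ∈ Set.Icc (0 : ℝ) (2 * π),
      Real.exp (-(2 * r ^ 2 * (Real.cos t - u) ^ 2)) ≤ G (t - a) + G ((2 * π - a) - t) := by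
    intro t ht
    rcases le_total t π with h1 | h1
    · linarith [hcore t ht.1 h1, hGpos ((2 * π - a) - t)]
    · have := hcore (2 * π - t) (by linarith [ht.2]) (by linarith)
      rw [Real.cos_two_pi_sub, show 2 * π - t - a = (2 * π - a) - t by ring] at this
      linarith [hGpos (t - a)]
  have hi1 : Integrable (fun t => G (t - a)) := hGint.comp_sub_right a
  have hi2 : Integrable (fun t => G ((2 * π - a) - t)) := hGint.comp_sub_left _
  calc ∫ t in (0 : ℝ)..2 * π, Real.exp (-(2 * r ^ 2 * (Real.cos t - u) ^ 2))
      ≤ ∫ t in (0 : ℝ)..2 * π, (G (t - a) + G ((2 * π - a) - t)) := by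
        apply intervalIntegral.integral_mono_on (by positivity) _ _ hpt
        · exact Continuous.intervalIntegrable (by fun_prop) _ _
        · exact (hi1.add hi2).intervalIntegrable
    _ ≤ ∫ t, (G (t - a) + G ((2 * π - a) - t)) := by
        rw [intervalIntegral.integral_of_le (by positivity)]
        exact setIntegral_le_integral (hi1.add hi2)
          (Filter.Eventually.of_forall fun t => add_nonneg (hGpos _) (hGpos _))
    _ = 4 * Real.exp 1 * √(π / r) := by
        rw [integral_add hi1 hi2, integral_sub_right_eq_self G a,
          integral_sub_left_eq_self G volume (2 * π - a), hGval]
        ring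

lemma hp_real_complex (n : ℕ) (x : ℝ) :
    ((iteratedDeriv n (fun t : ℝ => Real.exp (-t ^ 2)) x : ℝ) : ℂ) =
      iteratedDeriv n (fun z : ℂ => Complex.exp (-z ^ 2)) x := by
  have hc : ContDiff ℂ ((⊤ : ℕ∞) : WithTop ℕ∞) (fun z : ℂ => Complex.exp (-z ^ 2)) := by fun_prop
  have hrr : ContDiff ℝ ((⊤ : ℕ∞) : WithTop ℕ∞) (fun t : ℝ => Real.exp (-t ^ 2)) := by fun_prop
  induction n generalizing x with
  | zero => simp
  | succ n ih =>
    rw [iteratedDeriv_succ, iteratedDeriv_succ]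
    have h1 : HasDerivAt (iteratedDeriv n (fun z : ℂ => Complex.exp (-z ^ 2)))
        (deriv (iteratedDeriv n (fun z : ℂ => Complex.exp (-z ^ 2))) x) (x : ℂ) :=
      ((hc.differentiable_iteratedDeriv n (by exact_mod_cast WithTop.coe_lt_coe.2 (ENat.natCast_lt_top n))) _).hasDerivAt
    have h2 := h1.comp_ofReal
    have h3 : HasDerivAt (iteratedDeriv n (fun t : ℝ => Real.exp (-t ^ 2)))
        (deriv (iteratedDeriv n (fun t : ℝ => Real.exp (-t ^ 2))) x) x :=
      ((hrr.differentiable_iteratedDeriv n (by exact_mod_cast WithTop.coe_lt_coe.2 (ENat.natCast_lt_top n))) _).hasDerivAt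
    have h4 := h3.ofReal_comp
    refine h4.unique ?_
    have h5 : (fun y : ℝ => ((iteratedDeriv n (fun t : ℝ => Real.exp (-t ^ 2)) y : ℝ) : ℂ)) =
        fun y : ℝ => iteratedDeriv n (fun z : ℂ => Complex.exp (-z ^ 2)) y := funext ih
    rw [h5]
    exact h2

lemma hp_cauchy (n : ℕ) (x r : ℝ) (hr : 0 < r) :
    |iteratedDeriv n (fun t : ℝ => Real.exp (-t ^ 2)) x| * Real.exp (x ^ 2 / 2) ≤
      n.factorial * (Real.exp (r ^ 2) * (4 * Real.exp 1 * √(π / r))) / r ^ n := by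
  have hd : Differentiable ℂ (fun z : ℂ => Complex.exp (-z ^ 2)) := by fun_prop
  have hps := (hd.hasFPowerSeriesOnBall (x : ℂ) (R := ⟨r, hr.le⟩) hr).factorial_smul 1 n
  rw [iteratedFDeriv_apply_eq_iteratedDeriv_mul_prod, Finset.prod_const_one, one_smul] at hps
  have hle := norm_cauchyPowerSeries_le (fun z : ℂ => Complex.exp (-z ^ 2)) x r n
  have hnorm : ∀ t : ℝ, ‖Complex.exp (-(circleMap x r t) ^ 2)‖ =
      Real.exp (-(x ^ 2 / 2)) * Real.exp (r ^ 2) *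
        Real.exp (-(2 * r ^ 2 * (Real.cos t - (-x / (2 * r))) ^ 2)) := by
    intro t
    rw [Complex.norm_exp, ← Real.exp_add, ← Real.exp_add]
    congr 1
    have : circleMap x r t = ((x + r * Real.cos t : ℝ) : ℂ) + ((r * Real.sin t : ℝ) : ℂ) * Complex.I := by
      simp [circleMap, Complex.exp_mul_I]
      ring
    rw [this]
    have hre : (-(((x + r * Real.cos t : ℝ) : ℂ) + ((r * Real.sin t : ℝ) : ℂ) * Complex.I) ^ 2).re =
        -((x + r * Real.cos t) ^ 2 - (r * Real.sin t) ^ 2) := by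
      rw [pow_two, Complex.neg_re, Complex.mul_re, Complex.add_re, Complex.add_im,
        Complex.re_ofReal_mul, Complex.im_ofReal_mul, Complex.ofReal_re, Complex.ofReal_im,
        Complex.I_re, Complex.I_im]
      ring
    rw [hre]
    field_simp
    linear_combination (2 * r ^ 2) * Real.sin_sq_add_cos_sq t
  simp only [hnorm, intervalIntegral.integral_const_mul] at hle
  have hI := hp_integral_bound r (-x / (2 * r)) hr
  have hpi := Real.pi_gt_three
  set p := cauchyPowerSeries (fun z : ℂ => Complex.exp (-z ^ 2)) x r with hp
  have happ : ‖p n (fun _ => 1)‖ ≤ ‖p n‖ := by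
    simpa using (p n).le_opNorm (fun _ => 1)
  have h1 : |iteratedDeriv n (fun t : ℝ => Real.exp (-t ^ 2)) x| =
      n.factorial * ‖p n (fun _ => 1)‖ := by
    rw [← Real.norm_eq_abs, ← Complex.norm_real, hp_real_complex, ← hps, nsmul_eq_mul, norm_mul,
      Complex.norm_natCast]
    rfl
  set J := 4 * Real.exp 1 * √(π / r) with hJ
  have hJ0 : 0 ≤ J := by positivity
  have h2 : ‖p n‖ ≤ (Real.exp (-(x ^ 2 / 2)) * Real.exp (r ^ 2) * J) * (r ^ n)⁻¹ := by
    refine hle.trans ?_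
    rw [abs_of_pos hr, inv_pow]
    refine mul_le_mul_of_nonneg_right ?_ (by positivity)
    have h3 : (2 * π)⁻¹ ≤ 1 := inv_le_one_of_one_le₀ (by linarith)
    have h4 := mul_le_mul_of_nonneg_left hI
      (show 0 ≤ Real.exp (-(x ^ 2 / 2)) * Real.exp (r ^ 2) by positivity)
    calc _ ≤ (2 * π)⁻¹ * (Real.exp (-(x ^ 2 / 2)) * Real.exp (r ^ 2) * J) :=
          mul_le_mul_of_nonneg_left h4 (by positivity)
      _ ≤ 1 * (Real.exp (-(x ^ 2 / 2)) * Real.exp (r ^ 2) * J) :=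
          mul_le_mul_of_nonneg_right h3 (by positivity)
      _ = _ := one_mul _
  have h5 : Real.exp (-(x ^ 2 / 2)) * Real.exp (x ^ 2 / 2) = 1 := by
    rw [← Real.exp_add]; simp
  rw [h1]
  calc _ ≤ n.factorial * ((Real.exp (-(x ^ 2 / 2)) * Real.exp (r ^ 2) * J) * (r ^ n)⁻¹) *
        Real.exp (x ^ 2 / 2) := by
        have := happ.trans h2
        gcongr
    _ = n.factorial * (Real.exp (r ^ 2) * J) * (r ^ n)⁻¹ *
        (Real.exp (-(x ^ 2 / 2)) * Real.exp (x ^ 2 / 2)) := by ring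
    _ = _ := by rw [h5]; ring

lemma hp_stirling (n : ℕ) : ((n + 1).factorial : ℝ) * Real.exp ((n : ℝ) + 1) ≤
    Real.exp 1 * √((n : ℝ) + 1) * ((n : ℝ) + 1) ^ (n + 1) := by
  have h := Stirling.stirlingSeq'_antitone (Nat.zero_le n)
  simp only [Function.comp, Nat.succ_eq_add_one, zero_add] at h
  rw [Stirling.stirlingSeq_one, Stirling.stirlingSeq, div_le_iff₀ (by positivity)] at h
  push_cast at h
  rw [Real.sqrt_mul (by norm_num), div_pow, ← Real.exp_nat_mul] at h
  push_cast at h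
  rw [mul_one] at h
  have h2 : √(2 : ℝ) ≠ 0 := by positivity
  calc _ ≤ _ := mul_le_mul_of_nonneg_right h (Real.exp_pos _).le
    _ = _ := by field_simp

noncomputable def hpG (n : ℕ) : ℝ → ℝ := iteratedDeriv n (fun t : ℝ => Real.exp (-t ^ 2))

lemma hp_contDiff (n : ℕ) : ContDiff ℝ ((⊤ : ℕ∞) : WithTop ℕ∞) (hermitePsi n) := by
  have hrr : ContDiff ℝ ((⊤ : ℕ∞) : WithTop ℕ∞) (fun t : ℝ => Real.exp (-t ^ 2)) := by fun_prop
  have h : ContDiff ℝ ((⊤ : ℕ∞) : WithTop ℕ∞) (iteratedDeriv n (fun t : ℝ => Real.exp (-t ^ 2))) := by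
    induction n with
    | zero => simpa using hrr
    | succ n ih => rw [iteratedDeriv_succ]; exact (contDiff_infty_iff_deriv.1 ih).2
  unfold hermitePsi hermiteH
  fun_prop

lemma hp_G_hasDerivAt (n : ℕ) (x : ℝ) : HasDerivAt (hpG n) (hpG (n + 1) x) x := by
  have hrr : ContDiff ℝ ((⊤ : ℕ∞) : WithTop ℕ∞) (fun t : ℝ => Real.exp (-t ^ 2)) := by fun_prop
  unfold hpG
  rw [iteratedDeriv_succ]
  exact ((hrr.differentiable_iteratedDeriv n (by exact_mod_cast WithTop.coe_lt_coe.2 (ENat.natCast_lt_top n))) _).hasDerivAt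

lemma hp_G_one (x : ℝ) : hpG 1 x = -2 * x * hpG 0 x := by
  have h : HasDerivAt (hpG 0) (Real.exp (-x ^ 2) * (-(2 * x))) x := by
    have := ((hasDerivAt_pow 2 x).neg).exp
    simpa [hpG] using this
  rw [(hp_G_hasDerivAt 0 x).unique h]
  simp [hpG]; ring

lemma hp_G_rec (n : ℕ) (x : ℝ) :
    hpG (n + 2) x = -2 * x * hpG (n + 1) x - 2 * ((n : ℝ) + 1) * hpG n x := by
  induction n generalizing x with
  | zero =>
    have h := ((hasDerivAt_id x).const_mul (-2)).mul (hp_G_hasDerivAt 0 x)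
    have h3 : hpG 1 = fun y => -2 * y * hpG 0 y := funext hp_G_one
    have := (hp_G_hasDerivAt 1 x).unique (h.congr_of_eventuallyEq (Filter.Eventually.of_forall fun y => by rw [h3]; simp))
    simp at this ⊢
    linarith
  | succ n ih =>
    have h := (((hasDerivAt_id x).const_mul (-2)).mul (hp_G_hasDerivAt (n + 1) x)).sub
      ((hp_G_hasDerivAt n x).const_mul (2 * ((n : ℝ) + 1)))
    have h3 : hpG (n + 2) = fun y => -2 * y * hpG (n + 1) y - 2 * ((n : ℝ) + 1) * hpG n y :=
      funext ih
    have := (hp_G_hasDerivAt (n + 2) x).unique (h.congr_of_eventuallyEq (Filter.Eventually.of_forall fun y => by rw [h3]; simp))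
    simp at this ⊢
    linarith

lemma hp_psi_eq (n : ℕ) (x : ℝ) : hermitePsi n x =
    (-1) ^ n * Real.exp (x ^ 2 / 2) * hpG n x / √(2 ^ n * n.factorial * √π) := by
  unfold hermitePsi hermiteH hpG
  have : Real.exp (x ^ 2 / 2) = Real.exp (-x ^ 2 / 2) * Real.exp (x ^ 2) := by
    rw [← Real.exp_add]; congr 1; ring
  rw [this]; ring

lemma hp_norm_succ (n : ℕ) : √(2 ^ (n + 1) * (n + 1).factorial * √π) =
    √2 * √((n : ℝ) + 1) * √(2 ^ n * n.factorial * √π) := by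
  rw [← Real.sqrt_mul (by norm_num), ← Real.sqrt_mul (by positivity)]
  congr 1
  rw [Nat.factorial_succ]; push_cast; ring

lemma hp_psi_hasDerivAt (n : ℕ) (x : ℝ) : HasDerivAt (hermitePsi n)
    ((-1) ^ n * (Real.exp (x ^ 2 / 2) * (x * hpG n x + hpG (n + 1) x)) /
      √(2 ^ n * n.factorial * √π)) x := by
  have h0 : HasDerivAt (fun y : ℝ => Real.exp (y ^ 2 / 2)) (Real.exp (x ^ 2 / 2) * x) x := by
    have := ((hasDerivAt_pow 2 x).div_const 2).exp
    simpa using this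
  have h := ((h0.const_mul ((-1) ^ n)).mul (hp_G_hasDerivAt n x)).div_const
    √(2 ^ n * n.factorial * √π)
  have h1 : hermitePsi n = fun x => (-1) ^ n * Real.exp (x ^ 2 / 2) * hpG n x /
      √(2 ^ n * n.factorial * √π) := funext (hp_psi_eq n)
  rw [h1]
  refine h.congr_deriv ?_
  ring

lemma hp_deriv_zero : deriv (hermitePsi 0) = fun x => -(√(1 / 2)) * hermitePsi 1 x := by
  ext x
  rw [(hp_psi_hasDerivAt 0 x).deriv, hp_psi_eq, hp_norm_succ 0, hp_G_one]
  have h2 : √(2 : ℝ) ≠ 0 := by positivity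
  have hD : √(2 ^ 0 * (Nat.factorial 0 : ℝ) * √π) ≠ 0 := by positivity
  have hs : √(2 : ℝ) ^ 2 = 2 := Real.sq_sqrt (by norm_num)
  rw [Real.sqrt_div (by norm_num)]
  simp only [Nat.cast_zero, zero_add, Real.sqrt_one]
  field_simp
  rw [hs]; ring

lemma hp_deriv_succ (n : ℕ) : deriv (hermitePsi (n + 1)) = fun x =>
    √(((n : ℝ) + 1) / 2) * hermitePsi n x - √(((n : ℝ) + 2) / 2) * hermitePsi (n + 2) x := by
  ext x
  rw [(hp_psi_hasDerivAt (n + 1) x).deriv, hp_psi_eq, hp_psi_eq, hp_norm_succ (n + 1),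
    hp_norm_succ n, show n + 1 + 1 = n + 2 from rfl, hp_G_rec n]
  have h2 : √(2 : ℝ) ≠ 0 := by positivity
  have hs : √(2 : ℝ) ^ 2 = 2 := Real.sq_sqrt (by norm_num)
  have hD : √(2 ^ n * (Nat.factorial n : ℝ) * √π) ≠ 0 := by positivity
  have h3 : √((n : ℝ) + 1) ≠ 0 := by positivity
  have h4 : √((n : ℝ) + 2) ≠ 0 := by positivity
  have h5 : √((n : ℝ) + 1) ^ 2 = n + 1 := Real.sq_sqrt (by positivity)
  rw [Real.sqrt_div (by positivity), Real.sqrt_div (by positivity)]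
  rw [show (((n + 1 : ℕ) : ℝ) + 1) = (n : ℝ) + 2 by push_cast; ring]
  generalize √(2 ^ n * (Nat.factorial n : ℝ) * √π) = D at *
  rw [← sub_eq_zero]
  field_simp
  simp only [hs, h5, pow_succ]
  ring

lemma hp_psi_bound : ∃ K : ℝ, 0 ≤ K ∧ ∀ (n : ℕ) (x : ℝ), |hermitePsi n x| ≤ K := by
  refine ⟨√(16 * Real.exp 1 ^ 3 * √π * 2), Real.sqrt_nonneg _, fun n x => ?_⟩
  apply Real.abs_le_sqrt
  have hN : (0 : ℝ) < (n : ℝ) + 1 := by positivity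
  obtain ⟨r, hr⟩ : ∃ r, r = √(((n : ℝ) + 1) / 2) := ⟨_, rfl⟩
  have hr0 : 0 < r := by rw [hr]; positivity
  have hr2 : r ^ 2 = ((n : ℝ) + 1) / 2 := by rw [hr]; exact Real.sq_sqrt (by positivity)
  have hc := hp_cauchy n x r hr0
  have hst := hp_stirling n
  rw [hp_psi_eq, div_pow, Real.sq_sqrt (by positivity), div_le_iff₀ (by positivity)]
  have hsq := pow_le_pow_left₀ (by positivity) hc 2
  have hsN : √((n : ℝ) + 1) ≤ 2 * r := by
    rw [Real.sqrt_le_left (by positivity), mul_pow, hr2]; linarith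
  have hexp : Real.exp (r ^ 2) ^ 2 = Real.exp ((n : ℝ) + 1) := by
    rw [← Real.exp_nat_mul, hr2]; congr 1; push_cast; ring
  have hrn : (r ^ n) ^ 2 = ((n : ℝ) + 1) ^ n / 2 ^ n := by
    rw [← pow_mul, mul_comm, pow_mul, hr2, div_pow]
  have hpr : √(π / r) ^ 2 = π / r := Real.sq_sqrt (by positivity)
  have hpp : √π * √π = π := Real.mul_self_sqrt Real.pi_pos.le
  have hst2 : (n.factorial : ℝ) * Real.exp ((n : ℝ) + 1) ≤
      Real.exp 1 * (2 * r) * ((n : ℝ) + 1) ^ n := by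
    rw [Nat.factorial_succ] at hst
    push_cast at hst
    have : ((n : ℝ) + 1) * ((n.factorial : ℝ) * Real.exp ((n : ℝ) + 1)) ≤
        ((n : ℝ) + 1) * (Real.exp 1 * √((n : ℝ) + 1) * ((n : ℝ) + 1) ^ n) := by
      calc _ = _ := by ring
        _ ≤ _ := hst
        _ = _ := by ring
    refine (le_of_mul_le_mul_left this hN).trans ?_
    gcongr
  calc ((-1) ^ n * Real.exp (x ^ 2 / 2) * hpG n x) ^ 2
      = (|hpG n x| * Real.exp (x ^ 2 / 2)) ^ 2 := by
        rw [mul_pow, mul_pow, mul_pow, sq_abs, ← pow_mul, mul_comm n 2, pow_mul]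
        norm_num
        ring
    _ ≤ _ := hsq
    _ = n.factorial * (n.factorial * Real.exp ((n : ℝ) + 1)) *
        (16 * Real.exp 1 ^ 2 * (π / r)) * (2 ^ n / ((n : ℝ) + 1) ^ n) := by
        rw [div_pow, hrn, mul_pow, mul_pow, mul_pow, mul_pow, hexp, hpr]
        field_simp
        norm_num
    _ ≤ n.factorial * (Real.exp 1 * (2 * r) * ((n : ℝ) + 1) ^ n) *
        (16 * Real.exp 1 ^ 2 * (π / r)) * (2 ^ n / ((n : ℝ) + 1) ^ n) := by
        gcongr
    _ = 16 * Real.exp 1 ^ 3 * 2 * π * (2 ^ n * n.factorial) := by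
        field_simp
    _ = _ := by linear_combination (-(16 * Real.exp 1 ^ 3 * 2 * (2 ^ n * n.factorial))) * hpp

lemma hp_main (m : ℕ) : ∃ C : ℝ, 0 ≤ C ∧ ∀ (n : ℕ) (x : ℝ),
      |iteratedDeriv m (hermitePsi n) x| ≤ C * √((n : ℝ) + 1) ^ m := by
  induction m with
  | zero => simpa using hp_psi_bound
  | succ m ih =>
    obtain ⟨C, hC, h⟩ := ih
    have hcd : ∀ n x, ContDiffAt ℝ m (hermitePsi n) x := fun n x =>
      ((hp_contDiff n).of_le (by exact_mod_cast le_top)).contDiffAt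
    refine ⟨C * (1 + √2 ^ m), by positivity, fun n x => ?_⟩
    have hup : |iteratedDeriv m (hermitePsi (n + 1)) x| ≤ C * (√2 ^ m * √((n : ℝ) + 1) ^ m) := by
      refine (h (n + 1) x).trans ?_
      rw [← mul_pow, ← Real.sqrt_mul (by norm_num)]
      gcongr
      push_cast
      linarith [(Nat.cast_nonneg n : (0 : ℝ) ≤ n)]
    rw [iteratedDeriv_succ']
    have hhalf : √(((n : ℝ) + 1) / 2) ≤ √((n : ℝ) + 1) := by
      apply Real.sqrt_le_sqrt
      linarith [(Nat.cast_nonneg n : (0 : ℝ) ≤ n)]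
    have hup2 : √(((n : ℝ) + 1) / 2) * |iteratedDeriv m (hermitePsi (n + 1)) x| ≤
        √((n : ℝ) + 1) * (C * (√2 ^ m * √((n : ℝ) + 1) ^ m)) :=
      mul_le_mul hhalf hup (abs_nonneg _) (Real.sqrt_nonneg _)
    cases n with
    | zero =>
      rw [hp_deriv_zero, iteratedDeriv_const_mul_field, abs_mul, abs_neg,
        abs_of_nonneg (Real.sqrt_nonneg _)]
      simp only [Nat.cast_zero, zero_add] at hup2 ⊢
      refine hup2.trans ?_
      simp
      nlinarith
    | succ k =>
      rw [hp_deriv_succ, iteratedDeriv_fun_sub (contDiffAt_const.mul (hcd _ _))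
        (contDiffAt_const.mul (hcd _ _)), iteratedDeriv_const_mul_field,
        iteratedDeriv_const_mul_field]
      refine (abs_sub _ _).trans ?_
      rw [abs_mul, abs_mul, abs_of_nonneg (Real.sqrt_nonneg _), abs_of_nonneg (Real.sqrt_nonneg _)]
      have e : ((k + 1 : ℕ) : ℝ) + 1 = k + 2 := by push_cast; ring
      rw [e] at hup2 hup hhalf ⊢
      have hlow : √(((k : ℝ) + 1) / 2) * |iteratedDeriv m (hermitePsi k) x| ≤
          √((k : ℝ) + 2) * (C * √((k : ℝ) + 2) ^ m) := by
        refine mul_le_mul ?_ ((h k x).trans ?_) (abs_nonneg _) (Real.sqrt_nonneg _)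
        · apply Real.sqrt_le_sqrt
          linarith [(Nat.cast_nonneg k : (0 : ℝ) ≤ k)]
        · gcongr
          norm_num
      refine (add_le_add hlow hup2).trans (le_of_eq ?_)
      ring

theorem hermite_function_iteratedDeriv_bound (m : ℕ) (hm : 1 ≤ m) :
    ∃ C : ℝ, ∀ (n : ℕ) (x : ℝ),
      |iteratedDeriv m (hermitePsi n) x| ≤ C * ((n : ℝ) + 1) ^ ((m : ℝ) / 2) := by
  obtain ⟨C, -, h⟩ := hp_main m
  refine ⟨C, fun n x => (h n x).trans (le_of_eq ?_)⟩
  rw [Real.sqrt_eq_rpow, ← Real.rpow_natCast, ← Real.rpow_mul (by positivity)]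
  congr 2
  ring
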